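/- Let v₁, …, v_N be vectors in ℝ^m and let P be the uniform distribution on {v₁,…,v_N}. Then the χ²-divergence from the Gaussian mixture (1/N)·Σ_{i=1}^N N(v_i, I_m) to the standard Gaussian N(0, I_m) equals N^{-2} · Σ_{i,j=1}^N exp(⟨v_i, v_j⟩) − 1. -/

import Mathlib

open MeasureTheory ProbabilityTheory ENNReal

/-- The standard Gaussian measure `N(0, I_m)` on ℝ^m. -/
noncomputable def stdGaussian (m : ℕ) : Measure (Fin m → ℝ) :=
  Measure.pi fun _ => gaussianReal 0 1

/-- The χ²-divergence `χ²(P‖Q) = ∫ (dP/dQ)² dQ − 1` (real-valued version). -/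
noncomputable def chiSqDiv {α : Type*} [MeasurableSpace α] (P Q : Measure α) : ℝ :=
  (∫ x, ((P.rnDeriv Q x).toReal) ^ 2 ∂Q) - 1

/-- A product of measures with real densities has the product density. -/
theorem pi_withDensity_ofReal {ι : Type*} [Fintype ι] {X : ι → Type*}
    [∀ i, MeasurableSpace (X i)] (μ : ∀ i, Measure (X i)) [∀ i, SigmaFinite (μ i)]
    {f : ∀ i, X i → ℝ} (hf : ∀ i, Integrable (f i) (μ i)) (hf0 : ∀ i x, 0 ≤ f i x) :
    Measure.pi (fun i => (μ i).withDensity fun x => ENNReal.ofReal (f i x)) =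
      (Measure.pi μ).withDensity fun x => ENNReal.ofReal (∏ i, f i (x i)) := by
  have (i : ι) : SigmaFinite ((μ i).withDensity fun x => ENNReal.ofReal (f i x)) :=
    SigmaFinite.withDensity_ofReal (f i)
  refine Measure.pi_eq fun s hs => ?_
  rw [withDensity_apply _ (MeasurableSet.univ_pi hs), Measure.restrict_pi_pi,
    ← ofReal_integral_eq_lintegral_ofReal
      (Integrable.fintype_prod_dep fun i => (hf i).restrict)
      (.of_forall fun x => Finset.prod_nonneg fun i _ => hf0 i (x i)),
    integral_fintype_prod_eq_prod,
    ENNReal.ofReal_prod_of_nonneg fun i _ => integral_nonneg (hf0 i)]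
  refine Finset.prod_congr rfl fun i _ => ?_
  rw [withDensity_apply _ (hs i),
    ofReal_integral_eq_lintegral_ofReal (hf i).restrict (.of_forall (hf0 i))]

/-- A translate of the standard Gaussian on the line has density `exp (a x - a ^ 2 / 2)`. -/
theorem gaussianReal_one_eq_withDensity (a : ℝ) :
    gaussianReal a 1 =
      (gaussianReal 0 1).withDensity fun x => ENNReal.ofReal (Real.exp (a * x - a ^ 2 / 2)) := by
  rw [gaussianReal_of_var_ne_zero a one_ne_zero, gaussianReal_of_var_ne_zero 0 one_ne_zero,
    ← withDensity_mul _ (measurable_gaussianPDF 0 1) (by fun_prop)]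
  congr 1
  ext x
  rw [Pi.mul_apply, gaussianPDF, gaussianPDF, ← ENNReal.ofReal_mul (gaussianPDFReal_nonneg 0 1 x),
    gaussianPDFReal, gaussianPDFReal, mul_assoc _ (Real.exp _), ← Real.exp_add]
  congr 3
  push_cast
  ring

theorem integrable_exp_mul_sub_gaussianReal (a c : ℝ) :
    Integrable (fun x => Real.exp (a * x - c)) (gaussianReal 0 1) := by
  simp_rw [Real.exp_sub]
  exact (integrable_exp_mul_gaussianReal a).div_const _

/-- The density of `N(a, I_m)` with respect to `N(0, I_m)`. -/
noncomputable def gaussianShiftDensity {m : ℕ} (a x : Fin m → ℝ) : ℝ :=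
  ∏ k, Real.exp (a k * x k - a k ^ 2 / 2)

theorem gaussianShiftDensity_nonneg {m : ℕ} (a x : Fin m → ℝ) : 0 ≤ gaussianShiftDensity a x :=
  Finset.prod_nonneg fun _ _ => (Real.exp_pos _).le

theorem measurable_gaussianShiftDensity {m : ℕ} (a : Fin m → ℝ) :
    Measurable (gaussianShiftDensity a) := by
  unfold gaussianShiftDensity
  fun_prop

theorem stdGaussian_map_add {m : ℕ} (a : Fin m → ℝ) :
    (_root_.stdGaussian m).map (fun x => x + a) =
      (_root_.stdGaussian m).withDensity fun x => ENNReal.ofReal (gaussianShiftDensity a x) := by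
  have h (k : Fin m) : (gaussianReal 0 1).map (fun x => x + a k) = gaussianReal (a k) 1 := by
    rw [gaussianReal_map_add_const, zero_add]
  have (k : Fin m) : SigmaFinite ((gaussianReal 0 1).map fun x => x + a k) := by
    rw [h]; infer_instance
  calc (_root_.stdGaussian m).map (fun x => x + a)
      = Measure.pi fun k => (gaussianReal 0 1).map fun x => x + a k :=
        Measure.pi_map_pi (f := fun k x => x + a k) fun k => by fun_prop
    _ = _ := by
        rw [funext fun k => (h k).trans (gaussianReal_one_eq_withDensity (a k))]
        exact pi_withDensity_ofReal (fun _ => gaussianReal 0 1)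
          (fun k => integrable_exp_mul_sub_gaussianReal (a k) _) fun _ _ => (Real.exp_pos _).le

theorem gaussianShiftDensity_mul {m : ℕ} (a b x : Fin m → ℝ) :
    gaussianShiftDensity a x * gaussianShiftDensity b x =
      ∏ k, Real.exp ((a k + b k) * x k - (a k ^ 2 / 2 + b k ^ 2 / 2)) := by
  rw [gaussianShiftDensity, gaussianShiftDensity, ← Finset.prod_mul_distrib]
  refine Finset.prod_congr rfl fun k _ => ?_
  rw [← Real.exp_add]
  ring_nf

theorem integrable_gaussianShiftDensity_mul {m : ℕ} (a b : Fin m → ℝ) :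
    Integrable (fun x => gaussianShiftDensity a x * gaussianShiftDensity b x)
      (_root_.stdGaussian m) := by
  simp_rw [gaussianShiftDensity_mul]
  exact Integrable.fintype_prod fun k => integrable_exp_mul_sub_gaussianReal (a k + b k) _

theorem integral_gaussianShiftDensity_mul {m : ℕ} (a b : Fin m → ℝ) :
    ∫ x, gaussianShiftDensity a x * gaussianShiftDensity b x ∂(_root_.stdGaussian m) =
      Real.exp (∑ k, a k * b k) := by
  simp_rw [gaussianShiftDensity_mul, _root_.stdGaussian]
  rw [integral_fintype_prod_eq_prod
    (fun k (x : ℝ) => Real.exp ((a k + b k) * x - (a k ^ 2 / 2 + b k ^ 2 / 2))), Real.exp_sum]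
  refine Finset.prod_congr rfl fun k _ => ?_
  have h := congrFun (mgf_fun_id_gaussianReal (μ := 0) (v := 1)) (a k + b k)
  rw [mgf] at h
  simp_rw [Real.exp_sub]
  rw [integral_div, h, ← Real.exp_sub]
  congr 1
  push_cast
  ring

theorem gaussianMixture_eq_withDensity {m N : ℕ} (hN : 0 < N) (v : Fin N → (Fin m → ℝ)) :
    (N : ℝ≥0∞)⁻¹ • ∑ i : Fin N, (_root_.stdGaussian m).map (fun x => x + v i) =
      (_root_.stdGaussian m).withDensity fun x =>
        ENNReal.ofReal ((N : ℝ)⁻¹ * ∑ i, gaussianShiftDensity (v i) x) := by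
  have hmeas (i : Fin N) : Measurable fun x => ENNReal.ofReal (gaussianShiftDensity (v i) x) :=
    (measurable_gaussianShiftDensity (v i)).ennreal_ofReal
  have hdens (x : Fin m → ℝ) :
      ENNReal.ofReal ((N : ℝ)⁻¹ * ∑ i, gaussianShiftDensity (v i) x) =
        (N : ℝ≥0∞)⁻¹ * ∑ i, ENNReal.ofReal (gaussianShiftDensity (v i) x) := by
    rw [ENNReal.ofReal_mul (by positivity), ENNReal.ofReal_inv_of_pos (by positivity),
      ENNReal.ofReal_natCast,
      ENNReal.ofReal_sum_of_nonneg fun i _ => gaussianShiftDensity_nonneg (v i) x]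
  ext s hs
  simp_rw [stdGaussian_map_add, hdens]
  rw [withDensity_apply _ hs, lintegral_const_mul _ (Finset.measurable_fun_sum _ fun i _ => hmeas i),
    lintegral_finsetSum _ fun i _ => hmeas i]
  simp [withDensity_apply _ hs]

/-- For the uniform mixture of the Gaussians `N(v i, I_m)`, `i = 1, …, N`, the χ²-divergence
to the standard Gaussian `N(0,I_m)` equals `N⁻² ∑_{i,j} exp⟨v_i, v_j⟩ − 1`. -/
theorem stmt4 {m N : ℕ} (hN : 0 < N) (v : Fin N → (Fin m → ℝ)) :
    chiSqDiv ((N : ℝ≥0∞)⁻¹ • ∑ i : Fin N, (stdGaussian m).map (fun x => x + v i))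
        (stdGaussian m)
      = ((N : ℝ))⁻¹ ^ 2 * (∑ i : Fin N, ∑ j : Fin N, Real.exp (∑ k, v i k * v j k)) - 1 := by
  have : IsProbabilityMeasure (_root_.stdGaussian m) := by
    unfold _root_.stdGaussian; infer_instance
  have hmeas : Measurable fun x =>
      ENNReal.ofReal ((N : ℝ)⁻¹ * ∑ i, gaussianShiftDensity (v i) x) :=
    ((Finset.measurable_fun_sum _ fun i _ =>
      measurable_gaussianShiftDensity (v i)).const_mul _).ennreal_ofReal
  rw [chiSqDiv, gaussianMixture_eq_withDensity hN]
  congr 1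
  calc _ = ∫ x, (N : ℝ)⁻¹ ^ 2 *
        ∑ i, ∑ j, gaussianShiftDensity (v i) x * gaussianShiftDensity (v j) x
        ∂(_root_.stdGaussian m) := by
        refine integral_congr_ae ?_
        filter_upwards [Measure.rnDeriv_withDensity (_root_.stdGaussian m) hmeas] with x hx
        rw [hx, ENNReal.toReal_ofReal (mul_nonneg (by positivity)
          (Finset.sum_nonneg fun i _ => gaussianShiftDensity_nonneg (v i) x)), mul_pow,
          sq (∑ i, _), Finset.sum_mul_sum]
    _ = _ := by
        rw [integral_const_mul, integral_finsetSum _ fun i _ => integrable_finsetSum _ fun j _ =>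
          integrable_gaussianShiftDensity_mul (v i) (v j)]
        congr 1
        refine Finset.sum_congr rfl fun i _ => ?_
        rw [integral_finsetSum _ fun j _ => integrable_gaussianShiftDensity_mul (v i) (v j)]
        simp_rw [integral_gaussianShiftDensity_mul]
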